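/- arXiv:math/0409025 — 2 statements merged into one kernel-verified Lean document; each statement's English description precedes it below -/
import Mathlib

section
/- The Möbius function of the lattice of noncrossing partitions satisfies μ_NC(0̂_n, 1̂_n) = (-1)^{n-1} C_{n-1}, where C_m = (1/(m+1))·binom(2m, m) is the m-th Catalan number. -/
open Finset
open scoped Classical

/-- Two elements lie in the same block of the partition `P`. -/
def SameBlock {n : ℕ} (P : Finpartition (univ : Finset (Fin n))) (i j : Fin n) : Prop :=
  ∃ t ∈ P.parts, i ∈ t ∧ j ∈ t

/-- A partition of `{1,…,n}` is noncrossing. -/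
def IsNoncrossing {n : ℕ} (P : Finpartition (univ : Finset (Fin n))) : Prop :=
  ¬ ∃ i j k l : Fin n, i < j ∧ j < k ∧ k < l ∧
      SameBlock P i k ∧ SameBlock P j l ∧ ¬ SameBlock P i j

/-- The lattice `NC_n` of noncrossing partitions, as a subtype ordered by refinement. -/
abbrev NC (n : ℕ) := {P : Finpartition (univ : Finset (Fin n)) // IsNoncrossing P}

/-- The Möbius function of the (finite) poset `NC_n`. -/
noncomputable def ncMoebius (n : ℕ) (a b : NC n) : ℚ :=
  letI : LocallyFiniteOrder (NC n) := Fintype.toLocallyFiniteOrder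
  IncidenceAlgebra.mu ℚ a b

lemma isNoncrossing_bot {n : ℕ} : IsNoncrossing (⊥ : Finpartition (univ : Finset (Fin n))) := by
  rintro ⟨i, j, k, l, hij, hjk, hkl, ⟨t, ht, hit, hkt⟩, -, -⟩
  rw [Finpartition.mem_bot_iff] at ht
  obtain ⟨a, -, rfl⟩ := ht
  rw [Finset.mem_singleton] at hit hkt
  exact absurd (hij.trans hjk) (by rw [hit, hkt]; exact lt_irrefl a)

lemma isNoncrossing_top {n : ℕ} : IsNoncrossing (⊤ : Finpartition (univ : Finset (Fin n))) := by
  rintro ⟨i, j, k, l, hij, hjk, hkl, ⟨t, ht, hit, hkt⟩, -, hnij⟩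
  refine hnij ⟨t, ht, hit, ?_⟩
  have h := Finset.mem_singleton.mp (Finpartition.parts_top_subset _ ht)
  rw [h]
  exact Finset.mem_univ j

/-- `f` is the Möbius function `μ(b, ·)` of a finite poset, where `b` is the least element. -/
def IsMoebiusFrom {P : Type*} [PartialOrder P] [Fintype P] (b : P) (f : P → ℚ) : Prop :=
  ∀ y, ∑ x with x ≤ y, f x = if y = b then 1 else 0

namespace IsMoebiusFrom

variable {P Q : Type*} [PartialOrder P] [Fintype P] [PartialOrder Q] [Fintype Q]

lemma unique {b : P} {f g : P → ℚ} (hf : IsMoebiusFrom b f) (hg : IsMoebiusFrom b g) :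
    f = g := by
  funext y
  induction y using WellFoundedLT.induction with
  | ind y ih =>
    have hsplit : ∀ h : P → ℚ, ∑ x with x ≤ y, h x = h y + ∑ x with x < y, h x := by
      intro h
      rw [← Finset.sum_insert (by simp)]
      refine Finset.sum_congr ?_ fun _ _ => rfl
      ext x
      simp [le_iff_eq_or_lt]
    have h := (hf y).trans (hg y).symm
    rw [hsplit, hsplit, Finset.sum_congr rfl fun x hx => ih x (by simpa using hx)] at h
    exact add_right_cancel h

/-- Möbius functions restrict along the inclusion of a lower set containing the least element. -/
lemma comp_lowerSet {b : P} {c : Q} {f : Q → ℚ} (hf : IsMoebiusFrom c f) (φ : P ↪o Q)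
    (hb : φ b = c) (hφ : ∀ p q, q ≤ φ p → ∃ p', φ p' = q) :
    IsMoebiusFrom b (f ∘ φ) := by
  intro y
  have hy : φ y = c ↔ y = b := by rw [← hb, φ.injective.eq_iff]
  rw [← if_congr hy rfl rfl, ← hf (φ y)]
  refine Finset.sum_nbij φ (fun x hx => by simpa using hx) φ.injective.injOn ?_ fun _ _ => rfl
  intro q hq
  obtain ⟨p, rfl⟩ := hφ y q (by simpa using hq)
  exact ⟨p, by simpa using hq, rfl⟩

lemma prod {b : P} {c : Q} {f : P → ℚ} {g : Q → ℚ} (hf : IsMoebiusFrom b f)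
    (hg : IsMoebiusFrom c g) : IsMoebiusFrom (b, c) fun x => f x.1 * g x.2 := by
  rintro ⟨y, z⟩
  refine (Finset.sum_congr (s₂ := (univ.filter fun x : P => x ≤ y) ×ˢ
    (univ.filter fun x : Q => x ≤ z)) ?_ fun _ _ => rfl).trans ?_
  · ext x
    simp [Prod.le_def]
  rw [Finset.sum_product, ← Finset.sum_mul_sum, hf y, hg z]
  by_cases h₁ : y = b <;> by_cases h₂ : z = c <;> simp [h₁, h₂]

lemma mu {b : P} (hb : ∀ x, b ≤ x) :
    letI : LocallyFiniteOrder P := Fintype.toLocallyFiniteOrder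
    IsMoebiusFrom b fun x => IncidenceAlgebra.mu ℚ b x := by
  let : LocallyFiniteOrder P := Fintype.toLocallyFiniteOrder
  intro y
  have h := IncidenceAlgebra.sum_Icc_mu_right (𝕜 := ℚ) b y
  rw [show Finset.Icc b y = univ.filter (· ≤ y) by ext x; simp [hb x]] at h
  rw [h]
  exact if_congr eq_comm rfl rfl

/-- Weisner's theorem, for a closure operator in place of the join with a fixed element. -/
lemma sum_closure_eq_zero [DecidableEq P] {b : P} {f : P → ℚ} (hf : IsMoebiusFrom b f)
    (c : ClosureOperator P)
    (hb : c b ≠ b) (y : P) (hy : c y = y) : ∑ x with c x = y, f x = 0 := by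
  induction y using WellFoundedLT.induction with
  | ind y ih =>
    have hle : ∀ x, c x ≤ y ↔ x ≤ y := fun x => by
      exact (c.isClosed_iff.2 hy).closure_le_iff
    have hsum := hf y
    rw [if_neg (by rintro rfl; exact hb hy)] at hsum
    rw [← Finset.sum_fiberwise_of_maps_to (t := univ.filter (· ≤ y)) (g := c)
      (by simp [hle])] at hsum
    rw [Finset.sum_eq_single y] at hsum
    · rw [← hsum]
      refine Finset.sum_congr ?_ fun _ _ => rfl
      ext x
      simp only [mem_filter, mem_univ, true_and]
      exact ⟨fun h => ⟨(hle x).1 h.le, h⟩, fun h => h.2⟩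
    · intro z hz hzy
      have hzy' : z < y := lt_of_le_of_ne (by simpa using hz) hzy
      by_cases hcz : c z = z
      · rw [← ih z hzy' hcz]
        refine Finset.sum_congr ?_ fun _ _ => rfl
        ext x
        simp only [mem_filter, mem_univ, true_and]
        exact ⟨fun h => h.2, fun h => ⟨(hle x).1 (h.le.trans hzy'.le), h⟩⟩
      · refine Finset.sum_eq_zero fun x hx => absurd ?_ hcz
        rw [← (mem_filter.1 hx).2, c.idempotent]
    · simp

end IsMoebiusFrom

/-- A setoid on `Fin n` is noncrossing. -/
def Setoid.IsNoncrossing {n : ℕ} (s : Setoid (Fin n)) : Prop :=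
  ∀ ⦃i j k l⦄, i < j → j < k → k < l → s i k → s j l → s i j

/-- Noncrossing partitions of `Fin n`, presented as equivalence relations. -/
abbrev NCSetoid (n : ℕ) := {s : Setoid (Fin n) // s.IsNoncrossing}

namespace NCSetoid

noncomputable instance (n : ℕ) : Fintype (NCSetoid n) :=
  haveI : Finite (Setoid (Fin n)) :=
    Finite.of_injective (fun s i j => s i j) fun _ _ h =>
      Setoid.ext fun _ _ => iff_of_eq (congrFun₂ h _ _)
  Fintype.ofFinite _

instance (n : ℕ) : OrderBot (NCSetoid n) where
  bot := ⟨⊥, by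
    intro i j k l hij hjk _ hik _
    exact absurd (show i = k from hik) (hij.trans hjk).ne⟩
  bot_le s := (bot_le : ⊥ ≤ s.1)

instance (n : ℕ) : OrderTop (NCSetoid n) where
  top := ⟨⊤, fun _ _ _ _ _ _ _ _ _ => trivial⟩
  le_top s := (le_top : s.1 ≤ ⊤)

lemma le_def {n : ℕ} {s t : NCSetoid n} : s ≤ t ↔ ∀ i j, s.1 i j → t.1 i j :=
  ⟨fun h _ _ hij => h hij, fun h _ _ hij => h _ _ hij⟩

lemma ext_rel {n : ℕ} {s t : NCSetoid n} (h : ∀ i j, s.1 i j ↔ t.1 i j) : s = t :=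
  Subtype.ext (Setoid.ext h)

lemma bot_rel {n : ℕ} {i j : Fin n} : (⊥ : NCSetoid n).1 i j ↔ i = j := Iff.rfl

lemma top_rel {n : ℕ} (i j : Fin n) : (⊤ : NCSetoid n).1 i j := trivial

/-- The partition of `Fin n` into the elements below `m` and the elements not below `m`. -/
def cut (n m : ℕ) : NCSetoid n :=
  ⟨Setoid.ker fun i : Fin n => (i : ℕ) < m, by
    intro i j k l hij hjk hkl hik hjl
    simp only [Setoid.ker_def, eq_iff_iff, Fin.lt_def] at *
    omega⟩

lemma cut_rel {n m : ℕ} {i j : Fin n} : (cut n m).1 i j ↔ ((i : ℕ) < m ↔ (j : ℕ) < m) := by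
  exact Setoid.ker_def.trans eq_iff_iff

/-- The relation on `Fin (a + b)` that puts `p` and `q` side by side. -/
def glueRel {a b : ℕ} (p : Setoid (Fin a)) (q : Setoid (Fin b)) (x y : Fin (a + b)) : Prop :=
  Fin.addCases (fun i => Fin.addCases (fun j => p i j) (fun _ => False) y)
    (fun i => Fin.addCases (fun _ => False) (fun j => q i j) y) x

section glueRel

variable {a b : ℕ} {p : Setoid (Fin a)} {q : Setoid (Fin b)}

@[simp] lemma glueRel_left_left {i j : Fin a} :
    glueRel p q (Fin.castAdd b i) (Fin.castAdd b j) ↔ p i j := by simp [glueRel]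

@[simp] lemma glueRel_right_right {i j : Fin b} :
    glueRel p q (Fin.natAdd a i) (Fin.natAdd a j) ↔ q i j := by simp [glueRel]

@[simp] lemma glueRel_left_right {i : Fin a} {j : Fin b} :
    ¬ glueRel p q (Fin.castAdd b i) (Fin.natAdd a j) := by simp [glueRel]

@[simp] lemma glueRel_right_left {i : Fin b} {j : Fin a} :
    ¬ glueRel p q (Fin.natAdd a i) (Fin.castAdd b j) := by simp [glueRel]

end glueRel

/-- Noncrossing partitions of `Fin a` and `Fin b`, put side by side. -/
def glue {a b : ℕ} (p : NCSetoid a) (q : NCSetoid b) : NCSetoid (a + b) :=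
  ⟨{  r := glueRel p.1 q.1
      iseqv :=
      { refl := by
          intro x
          refine Fin.addCases (fun i => ?_) (fun i => ?_) x <;> simp
        symm := by
          intro x y
          refine Fin.addCases (fun i => ?_) (fun i => ?_) x <;>
          refine Fin.addCases (fun j => ?_) (fun j => ?_) y <;> simp
          · exact p.1.symm
          · exact q.1.symm
        trans := by
          intro x y z
          refine Fin.addCases (fun i => ?_) (fun i => ?_) x <;>
          refine Fin.addCases (fun j => ?_) (fun j => ?_) y <;>
          refine Fin.addCases (fun k => ?_) (fun k => ?_) z <;> simp
          · exact p.1.trans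
          · exact q.1.trans } }, by
    intro x y z w hxy hyz hzw hxz hyw
    change glueRel _ _ _ _ at hxz hyw
    change glueRel _ _ _ _
    revert hxy hyz hzw hxz hyw
    refine Fin.addCases (fun i => ?_) (fun i => ?_) x <;>
    refine Fin.addCases (fun j => ?_) (fun j => ?_) y <;>
    refine Fin.addCases (fun k => ?_) (fun k => ?_) z <;>
    refine Fin.addCases (fun l => ?_) (fun l => ?_) w <;> simp
    · exact fun h₁ h₂ h₃ => p.2 h₁ h₂ h₃
    · simp only [Fin.lt_def, Fin.val_castAdd, Fin.val_natAdd]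
      omega
    · simp only [Fin.lt_def, Fin.val_castAdd, Fin.val_natAdd]
      omega
    · exact fun h₁ h₂ h₃ => q.2 h₁ h₂ h₃⟩

lemma glue_rel {a b : ℕ} {p : NCSetoid a} {q : NCSetoid b} {x y : Fin (a + b)} :
    (glue p q).1 x y ↔ glueRel p.1 q.1 x y := Iff.rfl

lemma glue_le_glue {a b : ℕ} {p p' : NCSetoid a} {q q' : NCSetoid b} :
    glue p q ≤ glue p' q' ↔ p ≤ p' ∧ q ≤ q' := by
  simp only [le_def, glue_rel]
  refine ⟨fun h => ⟨fun i j => ?_, fun i j => ?_⟩, fun h x y => ?_⟩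
  · simpa using h (Fin.castAdd b i) (Fin.castAdd b j)
  · simpa using h (Fin.natAdd a i) (Fin.natAdd a j)
  · refine Fin.addCases (fun i => ?_) (fun i => ?_) x <;>
    refine Fin.addCases (fun j => ?_) (fun j => ?_) y <;> simp
    · exact h.1 i j
    · exact h.2 i j

lemma glue_bot (a b : ℕ) : glue (⊥ : NCSetoid a) (⊥ : NCSetoid b) = ⊥ := by
  refine ext_rel fun x y => ?_
  rw [glue_rel, bot_rel]
  refine Fin.addCases (fun i => ?_) (fun i => ?_) x <;>
  refine Fin.addCases (fun j => ?_) (fun j => ?_) y <;>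
  simp [Fin.ext_iff] <;> omega

lemma glue_top (a b : ℕ) : glue (⊤ : NCSetoid a) (⊤ : NCSetoid b) = cut (a + b) a := by
  refine ext_rel fun x y => ?_
  rw [glue_rel, cut_rel]
  refine Fin.addCases (fun i => ?_) (fun i => ?_) x <;>
  refine Fin.addCases (fun j => ?_) (fun j => ?_) y <;>
  simp [top_rel]

lemma exists_glue_of_le_cut {a b : ℕ} {s : NCSetoid (a + b)} (h : s ≤ cut (a + b) a) :
    ∃ p : NCSetoid a, ∃ q : NCSetoid b, glue p q = s := by
  refine ⟨⟨s.1.comap (Fin.castAdd b), fun i j k l h₁ h₂ h₃ h₄ h₅ =>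
      s.2 (i := Fin.castAdd b i) (j := Fin.castAdd b j) (k := Fin.castAdd b k)
        (l := Fin.castAdd b l) h₁ h₂ h₃ h₄ h₅⟩,
    ⟨s.1.comap (Fin.natAdd a), fun i j k l h₁ h₂ h₃ h₄ h₅ =>
      s.2 (i := Fin.natAdd a i) (j := Fin.natAdd a j) (k := Fin.natAdd a k)
        (l := Fin.natAdd a l) (by simpa using h₁) (by simpa using h₂) (by simpa using h₃)
        h₄ h₅⟩, ext_rel fun x y => ?_⟩
  rw [glue_rel]
  have hxy := le_def.1 h x y
  rw [cut_rel] at hxy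
  revert hxy
  refine Fin.addCases (fun i => ?_) (fun i => ?_) x <;>
  refine Fin.addCases (fun j => ?_) (fun j => ?_) y <;>
  simp [Setoid.comap_rel]

/-- The side-by-side embedding, whose range is the lower set generated by a two-block partition. -/
def glueEmbedding (a b : ℕ) : NCSetoid a × NCSetoid b ↪o NCSetoid (a + b) :=
  OrderEmbedding.ofMapLEIff (fun x => glue x.1 x.2) fun _ _ => glue_le_glue

lemma moebius_cut {a b : ℕ} {f : NCSetoid (a + b) → ℚ} {g : NCSetoid a → ℚ}
    {h : NCSetoid b → ℚ} (hf : IsMoebiusFrom ⊥ f) (hg : IsMoebiusFrom ⊥ g)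
    (hh : IsMoebiusFrom ⊥ h) : f (cut (a + b) a) = g ⊤ * h ⊤ := by
  have hcomp : IsMoebiusFrom (⊥, ⊥) (f ∘ glueEmbedding a b) := by
    refine hf.comp_lowerSet (glueEmbedding a b) (glue_bot a b) fun p s hs => ?_
    have hs' : s ≤ glue ⊤ ⊤ := hs.trans (glue_le_glue.2 ⟨le_top, le_top⟩)
    obtain ⟨p, q, rfl⟩ := exists_glue_of_le_cut (hs'.trans_eq (glue_top a b))
    exact ⟨(p, q), rfl⟩
  rw [← glue_top]
  exact congrFun (hcomp.unique (hg.prod hh)) (⊤, ⊤)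

/-- Being in the block of `0` or in the block of the last element. -/
def InEnds {n : ℕ} (s : NCSetoid (n + 2)) (i : Fin (n + 2)) : Prop :=
  s.1 i 0 ∨ s.1 i (Fin.last (n + 1))

/-- Merging the block of `0` with the block of the last element. -/
def mergeEnds {n : ℕ} (s : NCSetoid (n + 2)) : NCSetoid (n + 2) :=
  ⟨{  r := fun i j => s.1 i j ∨ (InEnds s i ∧ InEnds s j)
      iseqv :=
      { refl := fun i => Or.inl (s.1.refl i)
        symm := fun h => h.imp s.1.symm And.symm
        trans := by
          rintro i j k (h | h) (h' | h')
          · exact Or.inl (s.1.trans h h')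
          · exact Or.inr ⟨h'.1.imp (s.1.trans h) (s.1.trans h), h'.2⟩
          · exact Or.inr ⟨h.1, h.2.imp (s.1.trans (s.1.symm h')) (s.1.trans (s.1.symm h'))⟩
          · exact Or.inr ⟨h.1, h'.2⟩ } }, by
    intro i j k l hij hjk hkl hik hjl
    change _ ∨ _ at hik hjl
    change _ ∨ _
    rcases hik with hik | ⟨hi, hk⟩ <;> rcases hjl with hjl | ⟨hj, -⟩
    · exact Or.inl (s.2 hij hjk hkl hik hjl)
    · rcases hj with hj | hj
      · rcases (Fin.zero_le i).eq_or_lt with rfl | h0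
        · exact Or.inl (s.1.symm hj)
        · exact Or.inl (s.1.trans (s.1.symm (s.2 h0 hij hjk (s.1.symm hj) hik)) (s.1.symm hj))
      · exact Or.inl (s.2 hij hjk (hkl.trans_le (Fin.le_last l)) hik hj)
    · rcases hk with hk | hk
      · refine Or.inl (s.2 hij hjk hkl ?_ hjl)
        rcases hi with hi | hi
        · exact s.1.trans hi (s.1.symm hk)
        · rcases (Fin.zero_le i).eq_or_lt with rfl | h0
          · exact s.1.symm hk
          · have hik := hij.trans hjk
            have h := s.2 h0 hik (hkl.trans_le (Fin.le_last l)) (s.1.symm hk) hi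
            exact s.1.trans (s.1.symm h) (s.1.symm hk)
      · refine Or.inr ⟨hi, Or.inr ?_⟩
        rcases (Fin.le_last l).eq_or_lt with rfl | hl
        · exact hjl
        · exact s.1.trans (s.2 hjk hkl hl hjl hk) hk
    · exact Or.inr ⟨hi, hj⟩⟩

lemma mergeEnds_rel {n : ℕ} {s : NCSetoid (n + 2)} {i j : Fin (n + 2)} :
    (mergeEnds s).1 i j ↔ s.1 i j ∨ (InEnds s i ∧ InEnds s j) := Iff.rfl

lemma le_mergeEnds {n : ℕ} (s : NCSetoid (n + 2)) : s ≤ mergeEnds s :=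
  le_def.2 fun _ _ => Or.inl

lemma mergeEnds_zero_last {n : ℕ} (s : NCSetoid (n + 2)) :
    (mergeEnds s).1 0 (Fin.last (n + 1)) :=
  Or.inr ⟨Or.inl (s.1.refl _), Or.inr (s.1.refl _)⟩

lemma mergeEnds_le {n : ℕ} {s t : NCSetoid (n + 2)} (h : s ≤ t)
    (ht : t.1 0 (Fin.last (n + 1))) : mergeEnds s ≤ t := by
  rw [le_def] at h ⊢
  have hend : ∀ i, InEnds s i → t.1 i 0 := by
    rintro i (hi | hi)
    · exact h _ _ hi
    · exact t.1.trans (h _ _ hi) (t.1.symm ht)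
  rintro i j (hij | ⟨hi, hj⟩)
  · exact h _ _ hij
  · exact t.1.trans (hend i hi) (t.1.symm (hend j hj))

/-- Joining with the partition whose only nontrivial block consists of the two end points. -/
def mergeClosure (n : ℕ) : ClosureOperator (NCSetoid (n + 2)) :=
  ClosureOperator.mk' mergeEnds
    (fun _ t h => mergeEnds_le (h.trans (le_mergeEnds t)) (mergeEnds_zero_last t))
    le_mergeEnds
    fun s => mergeEnds_le le_rfl (mergeEnds_zero_last s)

lemma mergeClosure_apply {n : ℕ} (s : NCSetoid (n + 2)) : mergeClosure n s = mergeEnds s := rfl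

lemma mergeEnds_top (n : ℕ) : mergeEnds (⊤ : NCSetoid (n + 2)) = ⊤ :=
  top_le_iff.1 (le_mergeEnds ⊤)

lemma mergeEnds_bot_ne (n : ℕ) : mergeEnds (⊥ : NCSetoid (n + 2)) ≠ ⊥ := by
  intro h
  have h' := mergeEnds_zero_last (⊥ : NCSetoid (n + 2))
  rw [h, bot_rel] at h'
  simp [Fin.ext_iff] at h'

lemma mergeEnds_cut {n i : ℕ} (hi : i ≤ n) : mergeEnds (cut (n + 2) (i + 1)) = ⊤ := by
  refine top_le_iff.1 (le_def.2 fun x y _ => Or.inr ?_)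
  have hends : ∀ z, InEnds (cut (n + 2) (i + 1)) z := by
    intro z
    simp only [InEnds, cut_rel, Fin.val_zero, Fin.val_last]
    omega
  exact ⟨hends x, hends y⟩

lemma cut_ne_top {n i : ℕ} (hi : i ≤ n) : cut (n + 2) (i + 1) ≠ ⊤ := by
  intro h
  have h' := top_rel (0 : Fin (n + 2)) (Fin.last (n + 1))
  rw [← h, cut_rel] at h'
  simp only [Fin.val_zero, Fin.val_last] at h'
  omega

lemma cut_injOn (n : ℕ) : Set.InjOn (fun i => cut (n + 2) (i + 1)) (Set.Iic n) := by
  have key : ∀ i j, i < j → j ≤ n → cut (n + 2) (i + 1) ≠ cut (n + 2) (j + 1) := by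
    intro i j hij hj h
    have h' : (cut (n + 2) (j + 1)).1 0 ⟨j, by omega⟩ := by simp [cut_rel]
    rw [← h, cut_rel] at h'
    simp only [Fin.val_zero] at h'
    omega
  intro i hi j hj h
  rcases lt_trichotomy i j with hij | hij | hij
  · exact absurd h (key i j hij hj)
  · exact hij
  · exact absurd h.symm (key j i hij hi)

/-- The only partitions, apart from `⊤`, that become `⊤` after merging the end blocks are the
partitions into two intervals. -/
lemma eq_cut_of_mergeEnds_eq_top {n : ℕ} {s : NCSetoid (n + 2)} (h : mergeEnds s = ⊤)
    (hs : s ≠ ⊤) : ∃ i ≤ n, s = cut (n + 2) (i + 1) := by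
  have h0l : ¬ s.1 0 (Fin.last (n + 1)) := fun h0 =>
    hs (top_le_iff.1 (h ▸ mergeEnds_le le_rfl h0))
  have hends : ∀ i, InEnds s i := by
    intro i
    have hi : (mergeEnds s).1 i 0 := h ▸ top_rel i 0
    rcases hi with hi | hi
    · exact Or.inl hi
    · exact hi.1
  have hex : ∃ m : ℕ, ∃ hm : m < n + 2, s.1 ⟨m, hm⟩ (Fin.last (n + 1)) :=
    ⟨n + 1, by omega, s.1.refl _⟩
  obtain ⟨m, ⟨hm, hml⟩, hmin⟩ : ∃ m : ℕ, (∃ hm : m < n + 2, s.1 ⟨m, hm⟩ (Fin.last (n + 1))) ∧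
      ∀ x < m, ¬ ∃ hx : x < n + 2, s.1 ⟨x, hx⟩ (Fin.last (n + 1)) :=
    ⟨Nat.find hex, Nat.find_spec hex, fun _ => Nat.find_min hex⟩
  have hm0 : m ≠ 0 := by
    intro h0
    apply h0l
    rwa [show (⟨m, hm⟩ : Fin (n + 2)) = 0 from Fin.ext h0] at hml
  have hlow : ∀ x : Fin (n + 2), (x : ℕ) < m → s.1 x 0 := by
    intro x hx
    exact (hends x).resolve_right fun hxl => hmin x hx ⟨x.2, hxl⟩
  have hhigh : ∀ x : Fin (n + 2), ¬ (x : ℕ) < m → s.1 x (Fin.last (n + 1)) := by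
    intro x hx
    refine (hends x).resolve_left fun hx0 => h0l ?_
    rcases (Nat.le_of_not_lt hx).eq_or_lt with hxm | hxm
    · have : x = ⟨m, hm⟩ := Fin.ext hxm.symm
      subst this
      exact s.1.trans (s.1.symm hx0) hml
    · rcases (Fin.le_last x).eq_or_lt with hxl | hxl
      · subst hxl
        exact s.1.symm hx0
      · have hlt : (0 : Fin (n + 2)) < ⟨m, hm⟩ := by
          rw [Fin.lt_def]
          exact Nat.pos_of_ne_zero hm0
        exact s.1.trans (s.2 hlt (Fin.lt_def.2 hxm) hxl (s.1.symm hx0) hml) hml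
  refine ⟨m - 1, by omega, ext_rel fun x y => ?_⟩
  rw [cut_rel, Nat.sub_add_cancel (Nat.pos_of_ne_zero hm0)]
  have hsep : ∀ x y : Fin (n + 2), (x : ℕ) < m → ¬ (y : ℕ) < m → ¬ s.1 x y := fun x y hx hy hxy =>
    h0l (s.1.trans (s.1.symm (hlow x hx)) (s.1.trans hxy (hhigh y hy)))
  by_cases hx : (x : ℕ) < m <;> by_cases hy : (y : ℕ) < m <;> simp only [hx, hy, iff_true,
    iff_false, not_true]
  · exact s.1.trans (hlow x hx) (s.1.symm (hlow y hy))
  · exact hsep x y hx hy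
  · exact fun hxy => hsep y x hy hx (s.1.symm hxy)
  · exact s.1.trans (hhigh x hx) (s.1.symm (hhigh y hy))

lemma mergeEnds_eq_top_iff {n : ℕ} {s : NCSetoid (n + 2)} :
    mergeEnds s = ⊤ ↔ s = ⊤ ∨ ∃ i ≤ n, s = cut (n + 2) (i + 1) := by
  constructor
  · intro h
    by_cases hs : s = ⊤
    · exact Or.inl hs
    · exact Or.inr (eq_cut_of_mergeEnds_eq_top h hs)
  · rintro (rfl | ⟨i, hi, rfl⟩)
    · exact mergeEnds_top n
    · exact mergeEnds_cut hi

lemma moebius_top_add_sum_cut {n : ℕ} {f : NCSetoid (n + 2) → ℚ} (hf : IsMoebiusFrom ⊥ f) :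
    f ⊤ + ∑ i ∈ range (n + 1), f (cut (n + 2) (i + 1)) = 0 := by
  rw [← hf.sum_closure_eq_zero (mergeClosure n) (mergeEnds_bot_ne n) ⊤ (mergeEnds_top n),
    ← Finset.sum_image (f := f) (g := fun i => cut (n + 2) (i + 1)), ← Finset.sum_insert]
  · refine Finset.sum_congr ?_ fun _ _ => rfl
    ext s
    rw [mem_filter, mergeClosure_apply, mergeEnds_eq_top_iff]
    simp [eq_comm]
  · simp only [mem_image, mem_range, not_exists, not_and]
    exact fun i hi => cut_ne_top (by omega)
  · intro i hi j hj hij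
    exact cut_injOn n (by simpa [Nat.lt_succ_iff] using hi)
      (by simpa [Nat.lt_succ_iff] using hj) hij

theorem moebius_top (n : ℕ) (f : NCSetoid (n + 1) → ℚ) (hf : IsMoebiusFrom ⊥ f) :
    f ⊤ = (-1) ^ n * catalan n := by
  induction n using Nat.strong_induction_on with
  | _ n ih =>
    rcases n with _ | n
    · have htop : (⊤ : NCSetoid 1) = ⊥ :=
        ext_rel fun i j => by simp [Subsingleton.elim i j]
      have h := hf ⊤
      have huniv : (univ.filter fun x : NCSetoid 1 => x ≤ ⊤) = {⊤} := by
        ext x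
        simp only [le_top, filter_true, mem_univ, mem_singleton, true_iff]
        exact le_antisymm le_top (htop ▸ bot_le)
      rw [huniv, Finset.sum_singleton, if_pos htop] at h
      simpa using h
    · have h := moebius_top_add_sum_cut hf
      have hcut : ∀ i ∈ range (n + 1), f (cut (n + 2) (i + 1)) =
          (-1) ^ n * (catalan i * catalan (n - i) : ℕ) := by
        intro i hi
        obtain ⟨j, rfl⟩ := Nat.exists_eq_add_of_le (Nat.lt_succ_iff.1 (mem_range.1 hi))
        have hcast : ∀ N (hN : N = (i + 1) + (j + 1)) (g : NCSetoid N → ℚ),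
            IsMoebiusFrom ⊥ g → g (cut N (i + 1)) =
              ((-1) ^ i * catalan i) * ((-1) ^ j * catalan j) := by
          rintro _ rfl g hg
          have hi' := IsMoebiusFrom.mu (P := NCSetoid (i + 1)) (b := ⊥) fun _ => bot_le
          have hj' := IsMoebiusFrom.mu (P := NCSetoid (j + 1)) (b := ⊥) fun _ => bot_le
          rw [moebius_cut hg hi' hj', ih i (by omega) _ hi', ih j (by omega) _ hj']
        rw [hcast _ (by omega) f hf, Nat.add_sub_cancel_left]
        push_cast
        ring
      rw [Finset.sum_congr rfl hcut, ← Finset.mul_sum, ← Nat.cast_sum,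
        ← Nat.sum_antidiagonal_eq_sum_range_succ (fun i j => catalan i * catalan j),
        ← catalan_succ'] at h
      rw [eq_neg_of_add_eq_zero_left h]
      ring

end NCSetoid

section SameBlock

variable {n : ℕ} {P Q : Finpartition (univ : Finset (Fin n))}

lemma sameBlock_iff_mem_part {i j : Fin n} : SameBlock P i j ↔ j ∈ P.part i := by
  simp only [SameBlock, P.mem_part_iff_exists, and_comm]

lemma sameBlock_ofSetoid {s : Setoid (Fin n)} {i j : Fin n} :
    SameBlock (Finpartition.ofSetoid s) i j ↔ s i j :=
  sameBlock_iff_mem_part.trans Finpartition.mem_part_ofSetoid_iff_rel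

lemma le_iff_sameBlock : P ≤ Q ↔ ∀ i j, SameBlock P i j → SameBlock Q i j := by
  constructor
  · rintro h i j ⟨t, ht, hi, hj⟩
    obtain ⟨u, hu, htu⟩ := h ht
    exact ⟨u, hu, htu hi, htu hj⟩
  · intro h t ht
    obtain ⟨i, hi⟩ := P.nonempty_of_mem_parts ht
    refine ⟨Q.part i, Q.part_mem.2 (mem_univ i), fun j hj => ?_⟩
    exact sameBlock_iff_mem_part.1 (h i j ⟨t, ht, hi, hj⟩)

end SameBlock

/-- The noncrossing partition determined by a noncrossing equivalence relation. -/
noncomputable def NCSetoid.toNC {n : ℕ} : NCSetoid n ↪o NC n :=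
  OrderEmbedding.ofMapLEIff
    (fun s => ⟨Finpartition.ofSetoid s.1, by
      rintro ⟨i, j, k, l, hij, hjk, hkl, hik, hjl, h⟩
      rw [sameBlock_ofSetoid] at hik hjl h
      exact h (s.2 hij hjk hkl hik hjl)⟩)
    fun s t => by
      rw [← Subtype.coe_le_coe, le_iff_sameBlock, NCSetoid.le_def]
      simp only [sameBlock_ofSetoid]

lemma NCSetoid.toNC_surjective (n : ℕ) : Function.Surjective (NCSetoid.toNC (n := n)) := by
  intro P
  have hpart : ∀ i j, SameBlock P.1 i j ↔ P.1.part i = P.1.part j := fun i j => by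
    rw [sameBlock_iff_mem_part, P.1.mem_part_iff_part_eq_part (mem_univ _) (mem_univ _), eq_comm]
  let s : Setoid (Fin n) := Setoid.ker P.1.part
  have hs : ∀ i j, s i j ↔ SameBlock P.1 i j := fun i j => (hpart i j).symm
  refine ⟨⟨s, fun i j k l hij hjk hkl hik hjl => ?_⟩, Subtype.ext (le_antisymm ?_ ?_)⟩
  · rw [hs] at *
    by_contra h
    exact P.2 ⟨i, j, k, l, hij, hjk, hkl, hik, hjl, h⟩
  · exact le_iff_sameBlock.2 fun i j h => (hs i j).1 (sameBlock_ofSetoid.1 h)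
  · exact le_iff_sameBlock.2 fun i j h => sameBlock_ofSetoid.2 ((hs i j).2 h)

lemma NCSetoid.toNC_bot (n : ℕ) : NCSetoid.toNC (⊥ : NCSetoid n) = ⟨⊥, isNoncrossing_bot⟩ := by
  obtain ⟨s, hs⟩ := NCSetoid.toNC_surjective n ⟨⊥, isNoncrossing_bot⟩
  refine le_antisymm (hs ▸ NCSetoid.toNC.monotone bot_le) (Subtype.coe_le_coe.1 bot_le)

lemma NCSetoid.toNC_top (n : ℕ) : NCSetoid.toNC (⊤ : NCSetoid n) = ⟨⊤, isNoncrossing_top⟩ := by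
  obtain ⟨s, hs⟩ := NCSetoid.toNC_surjective n ⟨⊤, isNoncrossing_top⟩
  refine le_antisymm (Subtype.coe_le_coe.1 le_top) (hs ▸ NCSetoid.toNC.monotone le_top)

/-- `μ_NC(0̂_n, 1̂_n) = (-1)^{n-1} C_{n-1}`. -/
theorem stmt5 (n : ℕ) (hn : 1 ≤ n) :
    ncMoebius n ⟨⊥, isNoncrossing_bot⟩ ⟨⊤, isNoncrossing_top⟩ =
      (-1 : ℚ) ^ (n - 1) * (catalan (n - 1) : ℚ) := by
  obtain ⟨n, rfl⟩ := Nat.exists_eq_add_of_le' hn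
  have hmu := IsMoebiusFrom.mu (P := NC (n + 1)) (b := ⟨⊥, isNoncrossing_bot⟩)
    fun x => Subtype.coe_le_coe.1 bot_le
  have h := NCSetoid.moebius_top n _ (hmu.comp_lowerSet NCSetoid.toNC (NCSetoid.toNC_bot _)
    fun _ q _ => NCSetoid.toNC_surjective _ q)
  rw [Function.comp_apply, NCSetoid.toNC_top] at h
  rw [Nat.add_sub_cancel, ← h]
  unfold ncMoebius
  congr!
end

section
/- Let ã_n = Σ_{π ∈ NC_n^{≥2}} |μ_NC(π, 1̂_n)|, the sum over noncrossing partitions of {1,...,n} without singleton blocks of the absolute Möbius function to the maximal element. Then the generating function y(z) = Σ_{n≥1} ã_n z^n satisfies the algebraic equation y(1-y)(1-y-z) = z^2. -/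
open Finset
open scoped Classical

/-- `ã_n = Σ_{π ∈ NC_n, π without singleton blocks} |μ_NC(π, 1̂_n)|`. -/
noncomputable def atilde (n : ℕ) : ℚ :=
  ∑ π : NC n,
    if ∀ t ∈ π.1.parts, 2 ≤ t.card then |ncMoebius n π ⟨⊤, isNoncrossing_top⟩| else 0

open PowerSeries in
/-- The moment series `1 - X² / (1 - X)`. -/
noncomputable def momentSeries : ℚ⟦X⟧ := mk fun n => if n = 0 then 1 else if n = 1 then 0 else -1

open PowerSeries in
lemma momentSeries_mul_one_sub : momentSeries * (1 - X) = 1 - X - X ^ 2 := by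
  ext n
  rw [mul_sub, mul_one]
  rcases n with _ | _ | _ | n
  · simp [momentSeries]
  · simp [momentSeries, coeff_succ_mul_X, coeff_X_pow, coeff_one]
  · simp [momentSeries, coeff_succ_mul_X, coeff_X_pow, coeff_one, coeff_X]
  · simp [momentSeries, coeff_succ_mul_X, coeff_X_pow, coeff_one, coeff_X]

open PowerSeries in
lemma exists_cumulantSeries : ∃ K : ℚ⟦X⟧, constantCoeff K = 0 ∧
    -K * (1 + K) * (1 + K - X) = X ^ 2 ∧ K.subst (X * momentSeries) = momentSeries - 1 := by
  have h0 : constantCoeff (X * momentSeries) = 0 := by simp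
  have h1 : IsUnit (coeff 1 (X * momentSeries)) := by
    rw [show (1 : ℕ) = 0 + 1 from rfl, coeff_succ_X_mul]
    simp [momentSeries]
  have hW : HasSubst (X * momentSeries) := HasSubst.of_constantCoeff_zero' h0
  set V := substInvOfIsUnit (X * momentSeries) h1 with hVdef
  have hV : HasSubst V := HasSubst.substInvOfIsUnit ..
  have hVW : (X * momentSeries).subst V = X := subst_substInvOfIsUnit_right _ h0 h1
  have hWV : V.subst (X * momentSeries) = X := subst_substInvOfIsUnit_left _ h0 h1
  have e1 : V * momentSeries.subst V = X := by rw [← hVW, subst_mul hV, subst_X hV]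
  have one_subst : ∀ {a : ℚ⟦X⟧}, HasSubst a → (1 : ℚ⟦X⟧).subst a = (1 : ℚ⟦X⟧) := by
    intro a ha
    rw [← coe_substAlgHom ha, map_one]
  have e2 : momentSeries.subst V * (1 - V) = 1 - V - V ^ 2 := by
    have := congrArg (subst V) momentSeries_mul_one_sub
    rwa [subst_mul hV, subst_sub hV, subst_sub hV, subst_sub hV, subst_pow hV, subst_X hV,
      one_subst hV] at this
  refine ⟨momentSeries.subst V - 1, ?_, ?_, ?_⟩
  · have := congrArg constantCoeff e2
    have hv0 : constantCoeff V = 0 := constantCoeff_substInvOfIsUnit ..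
    simp [hv0] at this
    simp [this]
  · linear_combination (-(momentSeries.subst V) ^ 2) * e2 +
      (momentSeries.subst V * (1 - momentSeries.subst V) + (V * momentSeries.subst V + X)) * e1
  · rw [subst_sub hW, one_subst hW, subst_comp_subst_apply hV hW, hWV, X_subst]

open PowerSeries in
/-- `φ(w, n) = ∑_{k ≥ 1} w_k [zⁿ] (z M(z))ᵏ`. -/
noncomputable def firstBlockSum (w : ℕ → ℚ) (n : ℕ) : ℚ :=
  ∑ k ∈ range n, w (k + 1) * coeff n ((X * momentSeries) ^ (k + 1))

open PowerSeries in
lemma coeff_X_mul_pow_of_lt (M : ℚ⟦X⟧) {n k : ℕ} (h : n < k) : coeff n ((X * M) ^ k) = 0 := by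
  rw [mul_pow, coeff_X_pow_mul', if_neg (by omega)]

open PowerSeries in
lemma firstBlockSum_eq_sum_range (w : ℕ → ℚ) {n N : ℕ} (h : n ≤ N) :
    firstBlockSum w n = ∑ k ∈ range N, w (k + 1) * coeff n ((X * momentSeries) ^ (k + 1)) := by
  refine sum_subset (range_mono h) fun k _ hk => ?_
  rw [coeff_X_mul_pow_of_lt _ (by simpa using hk), mul_zero]

open PowerSeries in
lemma firstBlockSum_cumulant {K : ℚ⟦X⟧} (h : K.subst (X * momentSeries) = momentSeries - 1) {n : ℕ}
    (hn : n ≠ 0) : firstBlockSum (fun k => coeff k K) n = coeff n momentSeries := by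
  have hW : HasSubst (X * momentSeries) := HasSubst.of_constantCoeff_zero' (by simp)
  have := congrArg (coeff n) h
  rw [coeff_subst' hW, finsum_eq_sum_of_support_subset (s := range (n + 1)), sum_range_succ'] at this
  · simpa [firstBlockSum, coeff_one, hn] using this
  · intro k hk
    by_contra hk'
    apply hk
    simp only [coe_range, Set.mem_Iio, not_lt] at hk'
    simp only [coeff_X_mul_pow_of_lt momentSeries (show n < k by omega), smul_zero]

open PowerSeries in
lemma firstBlockSum_succ (w : ℕ → ℚ) (n : ℕ) : firstBlockSum w (n + 1) =
    ∑ j ∈ range (n + 1), (if j = 0 then w 1 else firstBlockSum (fun k => w (k + 1)) j) *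
      coeff (n - j) momentSeries := by
  have key : ∀ j ∈ range (n + 1), (if j = 0 then w 1 else firstBlockSum (fun k => w (k + 1)) j) =
      ∑ k ∈ range (n + 1), w (k + 1) * coeff j ((X * momentSeries) ^ k) := by
    intro j hj
    rw [sum_range_succ']
    split_ifs with h
    · subst h
      rw [sum_eq_zero]
      · simp
      · intro k _
        rw [coeff_X_mul_pow_of_lt _ (by omega), mul_zero]
    · rw [firstBlockSum_eq_sum_range (N := n) _ (by simp at hj; omega)]
      simp [coeff_one, h]
  rw [sum_congr rfl fun j hj => by rw [key j hj]]
  simp_rw [sum_mul]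
  rw [sum_comm, firstBlockSum]
  refine sum_congr rfl fun k _ => ?_
  rw [pow_succ', mul_assoc, coeff_succ_X_mul, mul_comm momentSeries, coeff_mul,
    Finset.Nat.sum_antidiagonal_eq_sum_range_succ_mk, mul_sum]
  exact sum_congr rfl fun j _ => by ring

lemma sum_card_filter_lt {α : Type*} [LinearOrder α] (U : Finset α) (f : ℕ → ℚ) :
    ∑ b ∈ U, f #{x ∈ U | x < b} = ∑ i ∈ range #U, f i := by
  induction U using Finset.induction_on_max with
  | empty => simp
  | insert a s h ih =>
    have ha : a ∉ s := fun h' => lt_irrefl _ (h a h')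
    rw [sum_insert ha, card_insert_of_notMem ha, sum_range_succ, add_comm, ← ih]
    congr 1
    · refine sum_congr rfl fun b hb => ?_
      rw [filter_insert, if_neg (h b hb).not_gt]
    · rw [filter_insert, if_neg (lt_irrefl a), filter_true_of_mem h]

section Families

variable {α : Type*} [LinearOrder α]

/-- No two different sets of the family cross. -/
def NoncrossingFamily (P : Finset (Finset α)) : Prop :=
  ∀ B ∈ P, ∀ C ∈ P, ∀ i ∈ B, ∀ j ∈ C, ∀ k ∈ B, ∀ l ∈ C, i < j → j < k → k < l → B = C

/-- The sets of the family are pairwise disjoint. -/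
def DisjointFamily (P : Finset (Finset α)) : Prop :=
  ∀ B ∈ P, ∀ C ∈ P, ∀ x, x ∈ B → x ∈ C → B = C

/-- `P` is a noncrossing partition of the union of `π` that refines the family `π`. -/
structure NoncrossingRefinement (π P : Finset (Finset α)) : Prop where
  empty_notMem : ∅ ∉ P
  disj : DisjointFamily P
  noncrossing : NoncrossingFamily P
  le : ∀ B ∈ P, ∃ V ∈ π, B ⊆ V
  exists_mem : ∀ V ∈ π, ∀ x ∈ V, ∃ B ∈ P, x ∈ B

variable [Fintype α]

/-- The set of noncrossing refinements of a family. -/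
noncomputable def noncrossingRefinements (π : Finset (Finset α)) : Finset (Finset (Finset α)) :=
  univ.filter (NoncrossingRefinement π)

lemma mem_noncrossingRefinements {π P : Finset (Finset α)} :
    P ∈ noncrossingRefinements π ↔ NoncrossingRefinement π P := by
  simp [noncrossingRefinements]

/-- The sum over the noncrossing refinements of a multiplicative weight. -/
noncomputable def blockSum (g : Finset α → ℚ) (π : Finset (Finset α)) : ℚ :=
  ∑ P ∈ noncrossingRefinements π, ∏ B ∈ P, g B

lemma blockSum_congr {g h : Finset α → ℚ} {π : Finset (Finset α)}
    (H : ∀ V ∈ π, ∀ B ⊆ V, B.Nonempty → g B = h B) : blockSum g π = blockSum h π := by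
  refine sum_congr rfl fun P hP => prod_congr rfl fun B hB => ?_
  have hP := mem_noncrossingRefinements.1 hP
  obtain ⟨V, hV, hBV⟩ := hP.le B hB
  exact H V hV B hBV (nonempty_iff_ne_empty.2 fun h => hP.empty_notMem (h ▸ hB))

lemma blockSum_of_isEmpty (g : Finset α → ℚ) (π : Finset (Finset α)) (h : ∀ V ∈ π, V = ∅) :
    blockSum g π = 1 := by
  have : noncrossingRefinements π = {∅} := by
    ext P
    rw [mem_noncrossingRefinements, mem_singleton]
    constructor
    · intro hP
      refine eq_empty_of_forall_notMem fun B hB => ?_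
      obtain ⟨V, hV, hBV⟩ := hP.le B hB
      rw [h V hV, subset_empty] at hBV
      exact hP.empty_notMem (hBV ▸ hB)
    · rintro rfl
      refine ⟨by simp, by simp [DisjointFamily], by simp [NoncrossingFamily], by simp, ?_⟩
      intro V hV x hx
      simp [h V hV] at hx
  simp [blockSum, this]

lemma blockSum_insert (g : Finset α → ℚ) {V : Finset α} {π : Finset (Finset α)} (hV : V ∉ π)
    (hd : DisjointFamily (insert V π)) (hn : NoncrossingFamily (insert V π)) :
    blockSum g (insert V π) = blockSum g {V} * blockSum g π := by
  have hdV : ∀ W ∈ π, ∀ x ∈ V, x ∉ W := fun W hW x hx hx' =>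
    hV (hd V (mem_insert_self _ _) W (mem_insert_of_mem hW) x hx hx' ▸ hW)
  have nsub : ∀ P : Finset (Finset α), ∅ ∉ P → (∀ B ∈ P, ∃ W ∈ π, B ⊆ W) → ∀ B ∈ P, ¬ B ⊆ V := by
    intro P hP hle B hB hBV
    obtain ⟨W, hW, hBW⟩ := hle B hB
    obtain ⟨x, hx⟩ := nonempty_iff_ne_empty.2 fun h => hP (h ▸ hB)
    exact hdV W hW x (hBV hx) (hBW hx)
  rw [blockSum, blockSum, blockSum, sum_mul_sum, ← sum_product']
  refine sum_bij' (fun P _ => (P.filter (· ⊆ V), P.filter (¬ · ⊆ V))) (fun Q _ => Q.1 ∪ Q.2)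
    ?_ ?_ ?_ ?_ ?_
  · intro P hP
    have hP := mem_noncrossingRefinements.1 hP
    have h0 := hP.empty_notMem
    have h1 := hP.disj
    have h2 := hP.noncrossing
    have h3 := hP.le
    have h4 := hP.exists_mem
    simp only [mem_product, mem_noncrossingRefinements]
    refine ⟨⟨?_, ?_, ?_, ?_, ?_⟩, ⟨?_, ?_, ?_, ?_, ?_⟩⟩
    · simp [h0]
    · intro B hB C hC; exact h1 B (mem_filter.1 hB).1 C (mem_filter.1 hC).1
    · intro B hB C hC; exact h2 B (mem_filter.1 hB).1 C (mem_filter.1 hC).1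
    · intro B hB; exact ⟨V, by simp, (mem_filter.1 hB).2⟩
    · intro W hW x hx
      rw [mem_singleton] at hW
      subst hW
      obtain ⟨B, hB, hxB⟩ := h4 W (mem_insert_self _ _) x hx
      refine ⟨B, mem_filter.2 ⟨hB, ?_⟩, hxB⟩
      obtain ⟨V', hV', hBV'⟩ := h3 B hB
      rwa [← hd V' hV' W (mem_insert_self _ _) x (hBV' hxB) hx]
    · simp [h0]
    · intro B hB C hC; exact h1 B (mem_filter.1 hB).1 C (mem_filter.1 hC).1
    · intro B hB C hC; exact h2 B (mem_filter.1 hB).1 C (mem_filter.1 hC).1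
    · intro B hB
      rw [mem_filter] at hB
      obtain ⟨V', hV', hBV'⟩ := h3 B hB.1
      rcases mem_insert.1 hV' with rfl | h
      · exact absurd hBV' hB.2
      · exact ⟨V', h, hBV'⟩
    · intro W hW x hx
      obtain ⟨B, hB, hxB⟩ := h4 W (mem_insert_of_mem hW) x hx
      exact ⟨B, mem_filter.2 ⟨hB, fun h => hdV W hW x (h hxB) hx⟩, hxB⟩
  · rintro ⟨P, Q⟩ hPQ
    simp only [mem_product, mem_noncrossingRefinements] at hPQ
    obtain ⟨hP, hQ⟩ := hPQ
    have hle : ∀ B ∈ P ∪ Q, ∃ W ∈ insert V π, B ⊆ W := by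
      intro B hB
      rcases mem_union.1 hB with hB | hB
      · obtain ⟨W, hW, h⟩ := hP.le B hB
        exact ⟨W, mem_insert.2 (.inl (mem_singleton.1 hW)), h⟩
      · obtain ⟨W, hW, h⟩ := hQ.le B hB
        exact ⟨W, mem_insert_of_mem hW, h⟩
    have hPV : ∀ B ∈ P, B ⊆ V := fun B hB => by
      obtain ⟨W, hW, h⟩ := hP.le B hB
      rwa [mem_singleton.1 hW] at h
    have hdisj : ∀ B ∈ P, ∀ C ∈ Q, ∀ x ∈ B, x ∉ C := by
      intro B hB C hC x hxB hxC
      obtain ⟨W, hW, h⟩ := hQ.le C hC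
      exact hdV W hW x (hPV B hB hxB) (h hxC)
    rw [mem_noncrossingRefinements]
    refine ⟨?_, ?_, ?_, hle, ?_⟩
    · simp [hP.empty_notMem, hQ.empty_notMem]
    · intro B hB C hC x hxB hxC
      rcases mem_union.1 hB with hB | hB <;> rcases mem_union.1 hC with hC | hC
      · exact hP.disj B hB C hC x hxB hxC
      · exact absurd hxC (hdisj B hB C hC x hxB)
      · exact absurd hxB (hdisj C hC B hB x hxC)
      · exact hQ.disj B hB C hC x hxB hxC
    · intro B hB C hC i hi j hj k hk l hl hij hjk hkl
      obtain ⟨W, hW, hBW⟩ := hle B hB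
      obtain ⟨W', hW', hCW'⟩ := hle C hC
      have hWW := hn W hW W' hW' i (hBW hi) j (hCW' hj) k (hBW hk) l (hCW' hl) hij hjk hkl
      subst hWW
      rcases mem_union.1 hB with hB | hB <;> rcases mem_union.1 hC with hC | hC
      · exact hP.noncrossing B hB C hC i hi j hj k hk l hl hij hjk hkl
      · obtain ⟨W', hW', hCW''⟩ := hQ.le C hC
        have : W = W' := hd W hW W' (mem_insert_of_mem hW') j (hCW' hj) (hCW'' hj)
        exact absurd (hBW hi) (this ▸ hdV W' hW' i (hPV B hB hi))
      · obtain ⟨W', hW', hBW''⟩ := hQ.le B hB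
        have : W = W' := hd W hW W' (mem_insert_of_mem hW') i (hBW hi) (hBW'' hi)
        exact absurd (hCW' hj) (this ▸ hdV W' hW' j (hPV C hC hj))
      · exact hQ.noncrossing B hB C hC i hi j hj k hk l hl hij hjk hkl
    · intro W hW x hx
      rcases mem_insert.1 hW with rfl | hW
      · obtain ⟨B, hB, h⟩ := hP.exists_mem W (by simp) x hx
        exact ⟨B, mem_union_left _ hB, h⟩
      · obtain ⟨B, hB, h⟩ := hQ.exists_mem W hW x hx
        exact ⟨B, mem_union_right _ hB, h⟩
  · intro P hP
    exact filter_union_filter_not_eq _ _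
  · rintro ⟨P, Q⟩ hPQ
    simp only [mem_product, mem_noncrossingRefinements] at hPQ
    obtain ⟨hP, hQ⟩ := hPQ
    have hPV : ∀ B ∈ P, B ⊆ V := fun B hB => by
      obtain ⟨W, hW, h⟩ := hP.le B hB
      rwa [mem_singleton.1 hW] at h
    have hQV := nsub Q hQ.empty_notMem hQ.le
    ext B <;> simp only [mem_filter, mem_union]
    · exact ⟨fun h => h.1.resolve_right fun h' => hQV B h' h.2, fun h => ⟨.inl h, hPV B h⟩⟩
    · exact ⟨fun h => h.1.resolve_left fun h' => h.2 (hPV B h'), fun h => ⟨.inr h, hQV B h⟩⟩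
  · intro P hP
    exact (prod_filter_mul_prod_filter_not P (· ⊆ V) g).symm

lemma blockSum_eq_prod (g : Finset α → ℚ) {π : Finset (Finset α)}
    (hd : DisjointFamily π) (hn : NoncrossingFamily π) :
    blockSum g π = ∏ V ∈ π, blockSum g {V} := by
  induction π using Finset.induction_on with
  | empty => simp [blockSum_of_isEmpty]
  | insert V π hV ih =>
    rw [blockSum_insert g hV hd hn, prod_insert hV, ih]
    · exact fun B hB C hC => hd B (mem_insert_of_mem hB) C (mem_insert_of_mem hC)
    · exact fun B hB C hC => hn B (mem_insert_of_mem hB) C (mem_insert_of_mem hC)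

/-- The weight which is `w |B|` on blocks containing `a` and `κ |B|` on the other ones. -/
noncomputable def markedWeight (κ w : ℕ → ℚ) (a : α) (B : Finset α) : ℚ :=
  if a ∈ B then w #B else κ #B

/-- The marked weight, restricted to blocks of `a` with maximum `b`. -/
noncomputable def markedMaxWeight (κ w : ℕ → ℚ) (a b : α) (B : Finset α) : ℚ :=
  if a ∈ B then (if b ∈ B ∧ ∀ x ∈ B, x ≤ b then w #B else 0) else κ #B

lemma blockSum_markedWeight_eq_sum (κ w : ℕ → ℚ) {a : α} {U : Finset α} (ha : a ∈ U) :
    blockSum (markedWeight κ w a) {U} = ∑ b ∈ U, blockSum (markedMaxWeight κ w a b) {U} := by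
  simp only [blockSum]
  rw [sum_comm]
  refine sum_congr rfl fun P hP => ?_
  have hP := mem_noncrossingRefinements.1 hP
  obtain ⟨B, hB, haB⟩ := hP.exists_mem U (by simp) a ha
  have hBU : B ⊆ U := by
    obtain ⟨W, hW, h⟩ := hP.le B hB
    rwa [mem_singleton.1 hW] at h
  have hne : ∀ C ∈ P.erase B, a ∉ C := fun C hC haC =>
    (mem_erase.1 hC).1 (hP.disj C (mem_erase.1 hC).2 B hB a haC haB)
  simp_rw [← mul_prod_erase P _ hB]
  have h1 : ∏ C ∈ P.erase B, markedWeight κ w a C = ∏ C ∈ P.erase B, κ #C :=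
    prod_congr rfl fun C hC => by simp [markedWeight, hne C hC]
  have h2 : ∀ b, ∏ C ∈ P.erase B, markedMaxWeight κ w a b C = ∏ C ∈ P.erase B, κ #C :=
    fun b => prod_congr rfl fun C hC => by simp [markedMaxWeight, hne C hC]
  simp_rw [h1, h2]
  rw [← sum_mul]
  congr 1
  have hBn : B.Nonempty := ⟨a, haB⟩
  rw [sum_eq_single_of_mem (B.max' hBn) (hBU (B.max'_mem hBn))]
  · simp only [markedWeight, markedMaxWeight, haB, if_true]
    rw [if_pos ⟨B.max'_mem hBn, fun x hx => B.le_max' x hx⟩]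
  · intro b _ hb
    simp only [markedMaxWeight, haB, if_true]
    rw [if_neg]
    exact fun h => hb (le_antisymm (B.le_max' b h.1) (h.2 _ (B.max'_mem hBn)))

lemma blockSum_markedMaxWeight_split (κ w : ℕ → ℚ) {a b : α} {U : Finset α} (ha : a ∈ U)
    (hmin : ∀ x ∈ U, a ≤ x) (hb : b ∈ U) :
    blockSum (markedMaxWeight κ w a b) {U} = blockSum (markedMaxWeight κ w a b) {U.filter (· ≤ b)} *
      blockSum (fun B => κ #B) {U.filter (b < ·)} := by
  have hab := hmin b hb
  have hmem : b ∈ U.filter (· ≤ b) := by simp [hb]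
  have hU : ∀ V ∈ ({U.filter (· ≤ b), U.filter (b < ·)} : Finset (Finset α)), V ⊆ U := by
    intro V hV
    simp only [mem_insert, mem_singleton] at hV
    rcases hV with rfl | rfl <;> exact filter_subset _ _
  have step : blockSum (markedMaxWeight κ w a b) {U} =
      blockSum (markedMaxWeight κ w a b) {U.filter (· ≤ b), U.filter (b < ·)} := by
    refine (sum_subset ?_ ?_).symm
    · intro P hP
      rw [mem_noncrossingRefinements] at hP ⊢
      refine ⟨hP.empty_notMem, hP.disj, hP.noncrossing, ?_, ?_⟩
      · intro B hB
        obtain ⟨V, hV, h⟩ := hP.le B hB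
        exact ⟨U, by simp, h.trans (hU V hV)⟩
      · intro V hV x hx
        rw [mem_singleton.1 hV] at hx
        rcases le_or_gt x b with h | h
        · exact hP.exists_mem (U.filter (· ≤ b)) (by simp) x (by simp [hx, h])
        · exact hP.exists_mem (U.filter (b < ·)) (by simp) x (by simp [hx, h])
    · intro P hP hP'
      rw [mem_noncrossingRefinements] at hP hP'
      by_contra hprod
      rw [← ne_eq, prod_ne_zero_iff] at hprod
      apply hP'
      have hPU : ∀ B ∈ P, B ⊆ U := fun B hB => by
        obtain ⟨W, hW, h⟩ := hP.le B hB
        rwa [mem_singleton.1 hW] at h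
      refine ⟨hP.empty_notMem, hP.disj, hP.noncrossing, ?_, fun V hV x hx =>
        hP.exists_mem U (by simp) x (hU V hV hx)⟩
      obtain ⟨A, hA, haA⟩ := hP.exists_mem U (by simp) a ha
      have hAb : b ∈ A ∧ ∀ x ∈ A, x ≤ b := by
        have := hprod A hA
        simp only [markedMaxWeight, haA, if_true] at this
        by_contra h
        exact this (if_neg h)
      intro B hB
      by_contra hno
      push Not at hno
      have h1 := hno (U.filter (· ≤ b)) (by simp)
      have h2 := hno (U.filter (b < ·)) (by simp)
      obtain ⟨y, hyB, hy⟩ := not_subset.1 h1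
      obtain ⟨x, hxB, hx⟩ := not_subset.1 h2
      simp only [mem_filter, hPU B hB hyB, true_and, not_le] at hy
      simp only [mem_filter, hPU B hB hxB, true_and, not_lt] at hx
      have hBA : B ≠ A := by
        rintro rfl
        exact absurd (hAb.2 y hyB) hy.not_ge
      have hxa : a ≠ x := by
        rintro rfl
        exact hBA (hP.disj B hB A hA _ hxB haA)
      have hxb : x ≠ b := by
        rintro rfl
        exact hBA (hP.disj B hB A hA _ hxB hAb.1)
      exact hBA (hP.noncrossing A hA B hB a haA x hxB b hAb.1 y hyB
        (lt_of_le_of_ne (hmin x (hPU B hB hxB)) hxa) (lt_of_le_of_ne hx hxb) hy).symm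
  rw [step, blockSum_insert]
  · congr 1
    refine blockSum_congr fun V hV B hBV _ => ?_
    rw [mem_singleton.1 hV] at hBV
    have : a ∉ B := fun h => absurd (mem_filter.1 (hBV h)).2 hab.not_gt
    simp [markedMaxWeight, this]
  · intro h
    rw [mem_singleton.1 h] at hmem
    simp at hmem
  · intro V hV W hW x hxV hxW
    simp only [mem_insert, mem_singleton] at hV hW
    rcases hV with rfl | rfl <;> rcases hW with rfl | rfl <;> simp only [mem_filter] at hxV hxW
    · rfl
    · exact absurd hxW.2 hxV.2.not_gt
    · exact absurd hxV.2 hxW.2.not_gt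
    · rfl
  · intro V hV W hW i hi j hj k hk l hl hij hjk hkl
    simp only [mem_insert, mem_singleton] at hV hW
    rcases hV with rfl | rfl <;> rcases hW with rfl | rfl <;> simp only [mem_filter] at hi hj hk hl
    · rfl
    · exact absurd (hj.2.trans hjk) hk.2.not_gt
    · exact absurd (hk.2.trans hkl) hl.2.not_gt
    · rfl

lemma blockSum_markedMaxWeight_self (κ w : ℕ → ℚ) (a : α) :
    blockSum (markedMaxWeight κ w a a) {{a}} = w 1 := by
  have : noncrossingRefinements {{a}} = {{{a}}} := by
    ext P
    rw [mem_noncrossingRefinements, mem_singleton]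
    constructor
    · intro hP
      have key : ∀ B ∈ P, B = {a} := fun B hB => by
        obtain ⟨W, hW, h⟩ := hP.le B hB
        rw [mem_singleton.1 hW] at h
        exact (subset_singleton_iff.1 h).resolve_left fun h => hP.empty_notMem (h ▸ hB)
      obtain ⟨B, hB, -⟩ := hP.exists_mem {a} (by simp) a (by simp)
      exact eq_singleton_iff_unique_mem.2 ⟨key B hB ▸ hB, key⟩
    · rintro rfl
      refine ⟨by simp, by simp [DisjointFamily], by simp [NoncrossingFamily], by simp, ?_⟩
      intro V hV x hx
      exact ⟨V, hV, hx⟩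
  simp [blockSum, this, markedMaxWeight]

lemma blockSum_markedMaxWeight_erase (κ w : ℕ → ℚ) {a b : α} {U : Finset α} (ha : a ∈ U)
    (hmin : ∀ x ∈ U, a ≤ x) (hb : b ∈ U) (hmax : ∀ x ∈ U, x ≤ b) (hab : a ≠ b) :
    blockSum (markedMaxWeight κ w a b) {U} =
      blockSum (markedWeight κ (fun k => w (k + 1)) a) {U.erase b} := by
  set S := (noncrossingRefinements {U}).filter fun P => ∃ B ∈ P, a ∈ B ∧ b ∈ B with hS
  have step : blockSum (markedMaxWeight κ w a b) {U} =
      ∑ P ∈ S, ∏ B ∈ P, markedMaxWeight κ w a b B := by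
    refine (sum_filter_of_ne fun P hP hprod => ?_).symm
    have hP := mem_noncrossingRefinements.1 hP
    obtain ⟨A, hA, haA⟩ := hP.exists_mem U (by simp) a ha
    have := prod_ne_zero_iff.1 hprod A hA
    refine ⟨A, hA, haA, ?_⟩
    by_contra h
    simp [markedMaxWeight, haA, h] at this
  set join : Finset α → Finset α := fun B => if a ∈ B then insert b B else B with hjoin
  have sub : ∀ {W : Finset α} {P}, NoncrossingRefinement {W} P → ∀ B ∈ P, B ⊆ W := by
    intro W P hP B hB
    obtain ⟨W, hW, h⟩ := hP.le B hB
    rwa [mem_singleton.1 hW] at h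
  have join_erase : ∀ P ∈ S, ∀ B ∈ P, join (B.erase b) = B := by
    intro P hP B hB
    obtain ⟨hP, A, hA, haA, hbA⟩ := mem_filter.1 hP
    have hP := mem_noncrossingRefinements.1 hP
    by_cases haB : a ∈ B
    · obtain rfl := hP.disj B hB A hA a haB haA
      simp [hjoin, hab, haA, insert_erase hbA]
    · have : b ∉ B := fun hbB => haB (hP.disj B hB A hA b hbB hbA ▸ haA)
      simp [hjoin, haB, erase_eq_of_notMem this]
  have erase_join : ∀ Q ∈ noncrossingRefinements {U.erase b}, ∀ B ∈ Q, (join B).erase b = B := by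
    intro Q hQ B hB
    have hbB : b ∉ B := fun h =>
      notMem_erase b U (sub (mem_noncrossingRefinements.1 hQ) B hB h)
    by_cases haB : a ∈ B
    · simp [hjoin, haB, erase_insert hbB]
    · simp [hjoin, haB, erase_eq_of_notMem hbB]
  rw [step, blockSum]
  refine sum_bij' (fun P _ => P.image (·.erase b)) (fun Q _ => Q.image join) ?_ ?_ ?_ ?_ ?_
  · intro P hP
    obtain ⟨hP, A, hA, haA, hbA⟩ := mem_filter.1 hP
    have hP := mem_noncrossingRefinements.1 hP
    rw [mem_noncrossingRefinements]
    refine ⟨?_, ?_, ?_, ?_, ?_⟩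
    · intro h
      obtain ⟨B, hB, hBe⟩ := mem_image.1 h
      obtain ⟨x, hx⟩ := nonempty_iff_ne_empty.2 fun h => hP.empty_notMem (h ▸ hB)
      by_cases hxb : x = b
      · obtain rfl := hP.disj B hB A hA b (hxb ▸ hx) hbA
        exact notMem_empty a (hBe ▸ mem_erase.2 ⟨hab, haA⟩)
      · exact notMem_empty x (hBe ▸ mem_erase.2 ⟨hxb, hx⟩)
    · intro B' hB' C' hC' x hxB hxC
      obtain ⟨B, hB, rfl⟩ := mem_image.1 hB'
      obtain ⟨C, hC, rfl⟩ := mem_image.1 hC'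
      rw [hP.disj B hB C hC x (mem_of_mem_erase hxB) (mem_of_mem_erase hxC)]
    · intro B' hB' C' hC' i hi j hj k hk l hl hij hjk hkl
      obtain ⟨B, hB, rfl⟩ := mem_image.1 hB'
      obtain ⟨C, hC, rfl⟩ := mem_image.1 hC'
      rw [hP.noncrossing B hB C hC i (mem_of_mem_erase hi) j (mem_of_mem_erase hj)
        k (mem_of_mem_erase hk) l (mem_of_mem_erase hl) hij hjk hkl]
    · intro B' hB'
      obtain ⟨B, hB, rfl⟩ := mem_image.1 hB'
      exact ⟨U.erase b, by simp, erase_subset_erase _ (sub hP B hB)⟩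
    · intro V hV x hx
      rw [mem_singleton.1 hV, mem_erase] at hx
      obtain ⟨B, hB, hxB⟩ := hP.exists_mem U (by simp) x hx.2
      exact ⟨B.erase b, mem_image_of_mem _ hB, mem_erase.2 ⟨hx.1, hxB⟩⟩
  · intro Q hQ
    have hQ := mem_noncrossingRefinements.1 hQ
    have sub_join : ∀ B, B ⊆ join B := fun B => by
      simp only [hjoin]; split_ifs
      · exact subset_insert _ _
      · exact Subset.rfl
    have of_mem_join : ∀ B x, x ∈ join B → x ∈ B ∨ x = b ∧ a ∈ B := by
      intro B x hx
      simp only [hjoin] at hx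
      split_ifs at hx with h
      · rcases mem_insert.1 hx with h' | h'
        · exact .inr ⟨h', h⟩
        · exact .inl h'
      · exact .inl hx
    obtain ⟨A, hA, haA⟩ := hQ.exists_mem (U.erase b) (by simp) a (mem_erase.2 ⟨hab, ha⟩)
    have hbA : b ∈ join A := by simp [hjoin, haA]
    have hjU : ∀ B ∈ Q, join B ⊆ U := by
      intro B hB x hx
      rcases of_mem_join B x hx with h | h
      · exact mem_of_mem_erase (sub hQ B hB h)
      · exact h.1 ▸ hb
    have hbQ : ∀ B ∈ Q, b ∉ B := fun B hB h => notMem_erase b U (sub hQ B hB h)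
    refine mem_filter.2 ⟨mem_noncrossingRefinements.2 ⟨?_, ?_, ?_, ?_, ?_⟩,
      join A, mem_image_of_mem _ hA, sub_join A haA, hbA⟩
    · intro h
      obtain ⟨B, hB, hBe⟩ := mem_image.1 h
      exact hQ.empty_notMem (subset_empty.1 (hBe ▸ sub_join B) ▸ hB)
    · intro B' hB' C' hC' x hxB hxC
      obtain ⟨B, hB, rfl⟩ := mem_image.1 hB'
      obtain ⟨C, hC, rfl⟩ := mem_image.1 hC'
      rcases of_mem_join B x hxB with h | ⟨rfl, h⟩ <;>
        rcases of_mem_join C x hxC with h' | ⟨h1, h'⟩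
      · rw [hQ.disj B hB C hC x h h']
      · exact absurd (h1 ▸ h) (hbQ B hB)
      · exact absurd h' (hbQ C hC)
      · rw [hQ.disj B hB C hC a h h']
    · intro B' hB' C' hC' i hi j hj k hk l hl hij hjk hkl
      obtain ⟨B, hB, rfl⟩ := mem_image.1 hB'
      obtain ⟨C, hC, rfl⟩ := mem_image.1 hC'
      have hlb : l ≤ b := hmax l (hjU C hC hl)
      have hkB := (of_mem_join B k hk).resolve_right fun h => (hkl.trans_le hlb).ne h.1
      have hjC := (of_mem_join C j hj).resolve_right fun h =>
        ((hjk.trans hkl).trans_le hlb).ne h.1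
      have hiB := (of_mem_join B i hi).resolve_right fun h =>
        ((hij.trans (hjk.trans hkl)).trans_le hlb).ne h.1
      rcases of_mem_join C l hl with h | ⟨-, h⟩
      · rw [hQ.noncrossing B hB C hC i hiB j hjC k hkB l h hij hjk hkl]
      · rcases (hmin i (hjU B hB hi)).eq_or_lt with rfl | h'
        · rw [hQ.disj B hB C hC a hiB h]
        · rw [hQ.noncrossing C hC B hB a h i hiB j hjC k hkB h' hij hjk]
    · intro B' hB'
      obtain ⟨B, hB, rfl⟩ := mem_image.1 hB'
      exact ⟨U, by simp, hjU B hB⟩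
    · intro V hV x hx
      rw [mem_singleton.1 hV] at hx
      by_cases hxb : x = b
      · exact ⟨join A, mem_image_of_mem _ hA, hxb ▸ hbA⟩
      · obtain ⟨B, hB, hxB⟩ := hQ.exists_mem (U.erase b) (by simp) x (mem_erase.2 ⟨hxb, hx⟩)
        exact ⟨join B, mem_image_of_mem _ hB, sub_join B hxB⟩
  · intro P hP
    change (P.image (·.erase b)).image join = P
    rw [image_image, image_congr (g := id), image_id]
    intro B hB
    exact join_erase P hP B hB
  · intro Q hQ
    change (Q.image join).image (·.erase b) = Q
    rw [image_image, image_congr (g := id), image_id]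
    intro B hB
    exact erase_join Q hQ B hB
  · intro P hP
    change _ = ∏ C ∈ P.image (·.erase b), _
    rw [prod_image]
    · refine prod_congr rfl fun B hB => ?_
      obtain ⟨hP, A, hA, haA, hbA⟩ := mem_filter.1 hP
      have hP := mem_noncrossingRefinements.1 hP
      by_cases haB : a ∈ B
      · obtain rfl := hP.disj B hB A hA a haB haA
        have : b ∈ B ∧ ∀ x ∈ B, x ≤ b := ⟨hbA, fun x hx => hmax x (sub hP B hB hx)⟩
        simp only [markedMaxWeight, markedWeight, haB, if_true, mem_erase, hab, ne_eq,
          not_false_eq_true, and_self, card_erase_add_one hbA]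
        rw [if_pos this]
      · have : b ∉ B := fun hbB => haB (hP.disj B hB A hA b hbB hbA ▸ haA)
        simp [markedMaxWeight, markedWeight, haB, erase_eq_of_notMem this]
    · intro B hB C hC h
      rw [← join_erase P hP B hB, ← join_erase P hP C hC]
      exact congrArg join h

open PowerSeries in
lemma blockSum_markedWeight {κ : ℕ → ℚ}
    (hκ : ∀ n, n ≠ 0 → firstBlockSum κ n = coeff n momentSeries) (w : ℕ → ℚ) {a : α}
    {U : Finset α} (ha : a ∈ U) (hmin : ∀ x ∈ U, a ≤ x) :
    blockSum (markedWeight κ w a) {U} = firstBlockSum w #U := by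
  induction hn : #U using Nat.strong_induction_on generalizing w a U with
  | _ n ih =>
  subst hn
  have moment : ∀ W : Finset α, #W < #U →
      blockSum (fun B => κ #B) {W} = coeff #W momentSeries := by
    intro W hW
    rcases W.eq_empty_or_nonempty with rfl | hne
    · rw [blockSum_of_isEmpty _ _ (by simp)]
      simp [momentSeries]
    · rw [← hκ _ hne.card_ne_zero, ← ih _ hW κ (W.min'_mem hne) (fun x hx => W.min'_le x hx) rfl]
      congr 1
      ext B
      simp [markedWeight]
  obtain ⟨n, hn⟩ : ∃ n, #U = n + 1 := Nat.exists_eq_succ_of_ne_zero (card_ne_zero_of_mem ha)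
  rw [blockSum_markedWeight_eq_sum κ w ha, hn, firstBlockSum_succ, ← hn, ← sum_card_filter_lt]
  refine sum_congr rfl fun b hb => ?_
  have hcard : #(U.filter (· < b)) + 1 + #(U.filter (b < ·)) = #U := by
    rw [← card_filter_add_card_filter_not (s := U) (· ≤ b)]
    congr 1
    · rw [← card_insert_of_notMem (a := b) (by simp)]
      congr 1
      ext x
      simp only [mem_insert, mem_filter, le_iff_lt_or_eq]
      grind
    · simp
  rw [blockSum_markedMaxWeight_split κ w ha hmin hb, moment _ (by omega)]
  congr 1
  · rcases (hmin b hb).eq_or_lt with rfl | hab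
    · have h1 : U.filter (· ≤ a) = {a} := by
        ext x
        simp only [mem_filter, mem_singleton]
        exact ⟨fun h => le_antisymm h.2 (hmin x h.1), by rintro rfl; exact ⟨ha, le_rfl⟩⟩
      have h2 : U.filter (· < a) = ∅ := by
        rw [filter_eq_empty_iff]
        exact fun x hx => (hmin x hx).not_gt
      simp [h1, h2, blockSum_markedMaxWeight_self]
    · have h1 : (U.filter (· ≤ b)).erase b = U.filter (· < b) := by
        ext x
        simp only [mem_erase, mem_filter, lt_iff_le_and_ne]
        tauto
      have ha' : a ∈ U.filter (· < b) := by simp [ha, hab]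
      rw [if_neg (card_ne_zero_of_mem ha'), blockSum_markedMaxWeight_erase κ w
        (by simp [ha, hab.le]) (fun x hx => hmin x (mem_filter.1 hx).1) (by simp [hb])
        (fun x hx => (mem_filter.1 hx).2) hab.ne, h1]
      exact ih _ (by omega) _ ha' (fun x hx => hmin x (mem_filter.1 hx).1) rfl
  · congr 2
    omega

open PowerSeries in
lemma blockSum_singleton {κ : ℕ → ℚ}
    (hκ : ∀ n, n ≠ 0 → firstBlockSum κ n = coeff n momentSeries) (U : Finset α) :
    blockSum (fun B => κ #B) {U} = coeff #U momentSeries := by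
  rcases U.eq_empty_or_nonempty with rfl | hne
  · rw [blockSum_of_isEmpty _ _ (by simp)]
    simp [momentSeries]
  · rw [← hκ _ hne.card_ne_zero,
      ← blockSum_markedWeight hκ κ (U.min'_mem hne) (fun x hx => U.min'_le x hx)]
    congr 1
    ext B
    simp [markedWeight]

end Families

section Moebius

lemma sum_moebius_filter_le {n : ℕ} (y t : NC n) (ht : ∀ x, x ≤ t) :
    ∑ x with y ≤ x, ncMoebius n x t = if y = t then 1 else 0 := by
  let _ : LocallyFiniteOrder (NC n) := Fintype.toLocallyFiniteOrder
  have h := IncidenceAlgebra.sum_Icc_mu_left (𝕜 := ℚ) y t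
  have h2 : (Icc y t : Finset (NC n)) = univ.filter (y ≤ ·) := by
    ext x
    simp [ht x]
  rw [h2] at h
  rw [← h]
  refine sum_congr rfl fun x _ => ?_
  unfold ncMoebius
  congr!

/-- Weisner's theorem, for a function `M` that is inverse to the zeta function. -/
lemma sum_filter_inf_eq_zero {L : Type*} [Fintype L] [DecidableEq L] [PartialOrder L] {c t : L} (hct : c ≠ t)
    (ht : ∀ x, x ≤ t) {f : L → L} (hf : ∀ x z, z ≤ f x ↔ z ≤ x ∧ z ≤ c) {M : L → ℚ}
    (hM : ∀ y, ∑ x with y ≤ x, M x = if y = t then 1 else 0) (y : L) (hy : y ≤ c) :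
    ∑ x with f x = y, M x = 0 := by
  induction y using WellFoundedGT.induction with
  | _ y ih =>
  have hyt : y ≠ t := by
    rintro rfl
    exact hct (le_antisymm (ht c) hy)
  have h1 : ∑ y' with y ≤ y' ∧ y' ≤ c, ∑ x with f x = y', M x = 0 := by
    rw [sum_fiberwise_eq_sum_filter, ← (hM y).trans (if_neg hyt)]
    refine sum_congr ?_ fun _ _ => rfl
    ext x
    have : f x ≤ c := ((hf x (f x)).1 le_rfl).2
    simp [hf, hy, this]
  rw [sum_eq_single_of_mem y (by simp [hy])] at h1
  · exact h1
  · intro z hz hzy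
    simp only [mem_filter, mem_univ, true_and] at hz
    exact ih z (lt_of_le_of_ne hz.1 hzy.symm) hz.2

variable {n : ℕ}

lemma sameBlock_iff {P : Finpartition (univ : Finset (Fin n))} {B : Finset (Fin n)}
    (hB : B ∈ P.parts) {i j : Fin n} (hi : i ∈ B) : SameBlock P i j ↔ j ∈ B := by
  constructor
  · rintro ⟨t, ht, hit, hjt⟩
    rwa [P.eq_of_mem_parts hB ht hi hit]
  · exact fun hj => ⟨B, hB, hi, hj⟩

lemma isNoncrossing_iff {P : Finpartition (univ : Finset (Fin n))} :
    IsNoncrossing P ↔ NoncrossingFamily P.parts := by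
  constructor
  · intro h B hB C hC i hi j hj k hk l hl hij hjk hkl
    by_contra hBC
    refine h ⟨i, j, k, l, hij, hjk, hkl, ⟨B, hB, hi, hk⟩, ⟨C, hC, hj, hl⟩, ?_⟩
    rw [sameBlock_iff hB hi]
    exact fun h => hBC (P.eq_of_mem_parts hB hC h hj)
  · rintro h ⟨i, j, k, l, hij, hjk, hkl, ⟨B, hB, hi, hk⟩, ⟨C, hC, hj, hl⟩, hn⟩
    obtain rfl := h B hB C hC i hi j hj k hk l hl hij hjk hkl
    exact hn ⟨B, hB, hi, hj⟩

lemma isNoncrossing_inf {P Q : Finpartition (univ : Finset (Fin n))} (hP : IsNoncrossing P)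
    (hQ : IsNoncrossing Q) : IsNoncrossing (P ⊓ Q) := by
  rw [isNoncrossing_iff] at *
  intro B hB C hC i hi j hj k hk l hl hij hjk hkl
  obtain ⟨B₁, hB₁, h1⟩ := (inf_le_left : P ⊓ Q ≤ P) hB
  obtain ⟨C₁, hC₁, h2⟩ := (inf_le_left : P ⊓ Q ≤ P) hC
  obtain ⟨B₂, hB₂, h3⟩ := (inf_le_right : P ⊓ Q ≤ Q) hB
  obtain ⟨C₂, hC₂, h4⟩ := (inf_le_right : P ⊓ Q ≤ Q) hC
  have e1 := hP B₁ hB₁ C₁ hC₁ i (h1 hi) j (h2 hj) k (h1 hk) l (h2 hl) hij hjk hkl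
  have e2 := hQ B₂ hB₂ C₂ hC₂ i (h3 hi) j (h4 hj) k (h3 hk) l (h4 hl) hij hjk hkl
  subst e1 e2
  have hmem : B₁ ∩ B₂ ∈ (P ⊓ Q).parts := by
    rw [Finpartition.parts_inf, mem_erase]
    exact ⟨ne_empty_of_mem (mem_inter.2 ⟨h1 hi, h3 hi⟩),
      mem_image.2 ⟨(B₁, B₂), mem_product.2 ⟨hB₁, hB₂⟩, rfl⟩⟩
  rw [(P ⊓ Q).eq_of_mem_parts hB hmem hi (mem_inter.2 ⟨h1 hi, h3 hi⟩),
    (P ⊓ Q).eq_of_mem_parts hC hmem hj (mem_inter.2 ⟨h2 hj, h4 hj⟩)]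

lemma exists_interval_part {P : Finpartition (univ : Finset (Fin n))} (hP : IsNoncrossing P)
    (hne : P.parts.Nonempty) : ∃ V ∈ P.parts, ∀ i ∈ V, ∀ k ∈ V, ∀ j, i < j → j < k → j ∈ V := by
  rw [isNoncrossing_iff] at hP
  obtain ⟨V, hV, hmin⟩ := exists_min_image P.parts
    (fun V => #{x | ∃ i ∈ V, ∃ k ∈ V, i ≤ x ∧ x ≤ k}) hne
  refine ⟨V, hV, fun i hi k hk j hij hjk => ?_⟩
  obtain ⟨W, hW, hjW⟩ := P.exists_mem (mem_univ j)
  by_contra hjV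
  have hVW : V ≠ W := fun h => hjV (h ▸ hjW)
  have hlow : ∀ w ∈ W, i < w := by
    intro w hw
    by_contra h
    rcases (not_lt.1 h).eq_or_lt with rfl | h
    · exact hVW (P.eq_of_mem_parts hV hW hi hw)
    · exact hVW (hP W hW V hV w hw i hi j hjW k hk h hij hjk).symm
  have hhigh : ∀ w ∈ W, w < k := by
    intro w hw
    by_contra h
    rcases (not_lt.1 h).eq_or_lt with rfl | h
    · exact hVW (P.eq_of_mem_parts hV hW hk hw)
    · exact hVW (hP V hV W hW i hi j hjW k hk w hw hij hjk h)
  refine absurd (hmin W hW) (not_le.2 (card_lt_card ?_))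
  rw [ssubset_iff_of_subset]
  · refine ⟨i, mem_filter.2 ⟨mem_univ _, i, hi, i, hi, le_rfl, le_rfl⟩, ?_⟩
    simp only [mem_filter, mem_univ, true_and, not_exists, not_and]
    exact fun w hw w' _ h => absurd h (hlow w hw).not_ge
  · intro x hx
    simp only [mem_filter, mem_univ, true_and] at hx ⊢
    obtain ⟨w, hw, w', hw', h, h'⟩ := hx
    exact ⟨i, hi, k, hk, (hlow w hw).le.trans h, h'.trans (hhigh w' hw').le⟩

/-- The partition with the blocks `V` and `Vᶜ`. -/
def complPartition (V : Finset (Fin n)) (hV : V ≠ ∅) (hV' : Vᶜ ≠ ∅) :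
    Finpartition (univ : Finset (Fin n)) :=
  Finpartition.ofExistsUnique {V, Vᶜ} (fun _ _ => subset_univ _)
    (fun x _ => by
      by_cases hx : x ∈ V
      · refine ⟨V, by simp [hx], ?_⟩
        rintro W ⟨hW, hxW⟩
        simp only [mem_insert, mem_singleton] at hW
        rcases hW with rfl | rfl
        · rfl
        · exact absurd hx (mem_compl.1 hxW)
      · refine ⟨Vᶜ, by simp [hx], ?_⟩
        rintro W ⟨hW, hxW⟩
        simp only [mem_insert, mem_singleton] at hW
        rcases hW with rfl | rfl
        · exact absurd hxW hx
        · rfl)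
    (by simp [hV.symm, hV'.symm])

lemma parts_complPartition (V : Finset (Fin n)) (hV : V ≠ ∅) (hV' : Vᶜ ≠ ∅) :
    (complPartition V hV hV').parts = {V, Vᶜ} := rfl

lemma isNoncrossing_complPartition {V : Finset (Fin n)} (hV : V ≠ ∅) (hV' : Vᶜ ≠ ∅)
    (h : ∀ i ∈ V, ∀ k ∈ V, ∀ j, i < j → j < k → j ∈ V) :
    IsNoncrossing (complPartition V hV hV') := by
  rw [isNoncrossing_iff, parts_complPartition]
  intro B hB C hC i hi j hj k hk l hl hij hjk hkl
  simp only [mem_insert, mem_singleton] at hB hC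
  rcases hB with rfl | rfl <;> rcases hC with rfl | rfl
  · rfl
  · exact absurd (h i hi k hk j hij hjk) (mem_compl.1 hj)
  · exact absurd (h j hj l hl k hjk hkl) (mem_compl.1 hk)
  · rfl

lemma card_parts_inf_complPartition {P : Finpartition (univ : Finset (Fin n))}
    {V : Finset (Fin n)} (hV : V ≠ ∅) (hV' : Vᶜ ≠ ∅)
    (hmem : V ∈ (P ⊓ complPartition V hV hV').parts) (hne : P ⊓ complPartition V hV hV' ≠ P) :
    #(P ⊓ complPartition V hV hV').parts = #P.parts + 1 := by
  obtain ⟨B, hB, hVB⟩ := (inf_le_left : P ⊓ complPartition V hV hV' ≤ P) hmem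
  have hdisj : ∀ D ∈ P.parts, D ≠ B → Disjoint D B := fun D hD h => P.disjoint hD hB h
  have hBV : B \ V ≠ ∅ := by
    intro h
    obtain rfl : V = B := hVB.antisymm (sdiff_eq_empty_iff_subset.1 h)
    refine hne (inf_eq_left.2 fun D hD => ?_)
    rw [parts_complPartition]
    by_cases hDV : D = V
    · exact ⟨V, by simp, hDV.le⟩
    · exact ⟨Vᶜ, by simp, le_compl_iff_disjoint_right.2 (hdisj D hD hDV)⟩
  have hVne := nonempty_iff_ne_empty.2 hV
  have hBVne := nonempty_iff_ne_empty.2 hBV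
  have key : (P ⊓ complPartition V hV hV').parts =
      insert V (insert (B \ V) (P.parts.erase B)) := by
    ext C
    rw [Finpartition.parts_inf, parts_complPartition, mem_erase]
    simp only [mem_image, mem_product, Prod.exists, mem_insert, mem_singleton, mem_erase]
    constructor
    · rintro ⟨hC, D, W, ⟨hD, rfl | rfl⟩, rfl⟩
      · by_cases hDB : D = B
        · subst hDB
          exact .inl (inter_eq_right.2 hVB)
        · exact absurd (disjoint_iff_inter_eq_empty.1 ((hdisj D hD hDB).mono_right hVB)) hC
      · by_cases hDB : D = B
        · subst hDB
          exact .inr (.inl (sdiff_eq_inter_compl _ _).symm)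
        · have : D ∩ Vᶜ = D :=
            inter_eq_left.2 (le_compl_iff_disjoint_right.2 ((hdisj D hD hDB).mono_right hVB))
          exact .inr (.inr (by simpa [this] using ⟨hDB, hD⟩))
    · rintro (rfl | rfl | ⟨hCB, hC⟩)
      · exact ⟨hV, B, C, ⟨hB, .inl rfl⟩, inter_eq_right.2 hVB⟩
      · exact ⟨hBV, B, Vᶜ, ⟨hB, .inr rfl⟩, (sdiff_eq_inter_compl _ _).symm⟩
      · exact ⟨P.ne_empty hC, C, Vᶜ, ⟨hC, .inr rfl⟩,
          inter_eq_left.2 (le_compl_iff_disjoint_right.2 ((hdisj C hC hCB).mono_right hVB))⟩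
  have hnot : ∀ D ⊆ B, D.Nonempty → D ∉ P.parts.erase B := by
    rintro D hDB ⟨x, hx⟩ hD
    exact disjoint_left.1 (hdisj D (mem_of_mem_erase hD) (ne_of_mem_erase hD)) hx (hDB hx)
  rw [key, card_insert_of_notMem, card_insert_of_notMem (hnot _ sdiff_subset hBVne),
    card_erase_add_one hB]
  rw [mem_insert, not_or]
  refine ⟨fun h => ?_, hnot V hVB hVne⟩
  obtain ⟨x, hx⟩ := hVne
  have := h ▸ hx
  exact (mem_sdiff.1 this).2 hx

lemma parts_top (hn : n ≠ 0) :
    (⊤ : Finpartition (univ : Finset (Fin n))).parts = {univ} := by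
  have := Fin.pos_iff_nonempty.1 (Nat.pos_of_ne_zero hn)
  exact (Finpartition.parts_nonempty _ univ_nonempty.ne_empty).subset_singleton_iff.1
    (Finpartition.parts_top_subset _)

lemma abs_ncMoebius (hn : n ≠ 0) (π : NC n) :
    |ncMoebius n π ⟨⊤, isNoncrossing_top⟩| =
      -(-1) ^ #π.1.parts * ncMoebius n π ⟨⊤, isNoncrossing_top⟩ := by
  set t : NC n := ⟨⊤, isNoncrossing_top⟩ with ht_def
  have ht : ∀ x : NC n, x ≤ t := fun x => (le_top : x.1 ≤ ⊤)
  have : Nonempty (Fin n) := Fin.pos_iff_nonempty.1 (Nat.pos_of_ne_zero hn)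
  suffices h : 0 ≤ -(-1) ^ #π.1.parts * ncMoebius n π t by
    rw [← abs_of_nonneg h, abs_mul, abs_neg, abs_pow, abs_neg, abs_one, one_pow, one_mul]
  induction hk : #π.1.parts using Nat.strong_induction_on generalizing π with
  | _ k ih =>
  subst hk
  by_cases hπ : π = t
  · have : ncMoebius n π t = 1 := by
      rw [hπ, ncMoebius]
      exact @IncidenceAlgebra.mu_self ℚ _ _ _ _ (Fintype.toLocallyFiniteOrder) _ _
    rw [this, hπ, ht_def, parts_top hn]
    simp
  · obtain ⟨V, hVπ, hint⟩ := exists_interval_part π.2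
      (Finpartition.parts_nonempty _ univ_nonempty.ne_empty)
    have hV : V ≠ ∅ := π.1.ne_empty hVπ
    have hV' : Vᶜ ≠ ∅ := by
      intro h
      rw [compl_eq_empty_iff] at h
      refine hπ (le_antisymm (ht π) fun B hB => ⟨univ, h ▸ hVπ, subset_univ _⟩)
    set c : NC n := ⟨complPartition V hV hV', isNoncrossing_complPartition hV hV' hint⟩ with hc
    have hct : c ≠ t := by
      intro h
      have h1 : V ∈ (⊤ : Finpartition (univ : Finset (Fin n))).parts := by
        rw [← show c.1 = ⊤ from congrArg Subtype.val h]
        exact mem_insert_self _ _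
      rw [parts_top hn, mem_singleton] at h1
      exact hV' (by rw [h1, compl_univ])
    have hπc : π ≤ c := by
      intro B hB
      by_cases hBV : B = V
      · exact ⟨V, mem_insert_self _ _, hBV.le⟩
      · exact ⟨Vᶜ, by simp [hc, parts_complPartition],
          le_compl_iff_disjoint_right.2 (π.1.disjoint hB hVπ hBV)⟩
    let f : NC n → NC n := fun x => ⟨x.1 ⊓ c.1, isNoncrossing_inf x.2 c.2⟩
    have hf : ∀ x z, z ≤ f x ↔ z ≤ x ∧ z ≤ c := fun x z =>
      (le_inf_iff : z.1 ≤ x.1 ⊓ c.1 ↔ _)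
    have hw := sum_filter_inf_eq_zero hct ht hf (fun y => sum_moebius_filter_le y t ht) π hπc
    have hπf : f π = π := Subtype.ext (inf_eq_left.2 hπc)
    rw [← add_sum_erase _ _ (show π ∈ univ.filter (f · = π) by simp [hπf])] at hw
    rw [eq_neg_of_add_eq_zero_left hw, neg_mul_neg, mul_sum]
    refine sum_nonneg fun x hx => ?_
    simp only [mem_erase, mem_filter, mem_univ, true_and] at hx
    have hfx : x.1 ⊓ complPartition V hV hV' = π.1 := congrArg Subtype.val hx.2
    have hcard : #π.1.parts = #x.1.parts + 1 := by
      rw [← hfx]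
      refine card_parts_inf_complPartition hV hV' (hfx ▸ hVπ) fun h => hx.1 (Subtype.ext ?_)
      rw [← h, hfx]
    have := ih _ (by omega) x rfl
    rw [hcard, pow_succ]
    linarith

lemma sum_filter_le_prod_eq_blockSum (g : Finset (Fin n) → ℚ) (π : NC n) :
    ∑ σ : NC n with σ ≤ π, ∏ B ∈ σ.1.parts, g B = blockSum g π.1.parts := by
  refine sum_bij (fun σ _ => σ.1.parts) ?_ ?_ ?_ ?_
  · intro σ hσ
    rw [mem_noncrossingRefinements]
    refine ⟨σ.1.empty_notMem_parts, fun B hB C hC x => σ.1.eq_of_mem_parts hB hC,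
      isNoncrossing_iff.1 σ.2, fun B hB => (mem_filter.1 hσ).2 hB,
      fun V hV x hx => σ.1.exists_mem (mem_univ x)⟩
  · exact fun σ _ τ _ h => Subtype.ext (Finpartition.ext h)
  · intro P hP
    have hP := mem_noncrossingRefinements.1 hP
    let σ : Finpartition (univ : Finset (Fin n)) :=
      Finpartition.ofExistsUnique P (fun _ _ => subset_univ _)
        (fun x _ => by
          obtain ⟨V, hV, hxV⟩ := π.1.exists_mem (mem_univ x)
          obtain ⟨B, hB, hxB⟩ := hP.exists_mem V hV x hxV
          exact ⟨B, ⟨hB, hxB⟩, fun C hC => hP.disj C hC.1 B hB x hC.2 hxB⟩)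
        hP.empty_notMem
    refine ⟨⟨σ, isNoncrossing_iff.2 hP.noncrossing⟩, ?_, rfl⟩
    exact mem_filter.2 ⟨mem_univ _, fun B hB => hP.le B hB⟩
  · exact fun _ _ => rfl

open PowerSeries in
lemma atilde_eq_neg {κ : ℕ → ℚ}
    (hκ : ∀ n, n ≠ 0 → firstBlockSum κ n = coeff n momentSeries) (hn : n ≠ 0) :
    atilde n = -κ n := by
  set t : NC n := ⟨⊤, isNoncrossing_top⟩ with ht_def
  have ht : ∀ x : NC n, x ≤ t := fun x => (le_top : x.1 ≤ ⊤)
  have hF : ∀ π : NC n, ∑ σ : NC n with σ ≤ π, ∏ B ∈ σ.1.parts, κ #B =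
      if ∀ B ∈ π.1.parts, 2 ≤ #B then (-1) ^ #π.1.parts else 0 := by
    intro π
    rw [sum_filter_le_prod_eq_blockSum (fun B => κ #B), blockSum_eq_prod _
      (fun B hB C hC x => π.1.eq_of_mem_parts hB hC) (isNoncrossing_iff.1 π.2)]
    simp_rw [blockSum_singleton hκ]
    split_ifs with h
    · refine prod_eq_pow_card fun B hB => ?_
      have := h B hB
      simp [momentSeries, show #B ≠ 0 by omega, show #B ≠ 1 by omega]
    · push Not at h
      obtain ⟨B, hB, h2⟩ := h
      have h0 : #B ≠ 0 := (π.1.nonempty_of_mem_parts hB).card_ne_zero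
      refine prod_eq_zero hB ?_
      simp [momentSeries, show #B = 1 by omega]
  calc atilde n
      = -∑ π : NC n, ∑ σ : NC n with σ ≤ π, (∏ B ∈ σ.1.parts, κ #B) * ncMoebius n π t := by
        rw [atilde, ← sum_neg_distrib]
        refine sum_congr rfl fun π _ => ?_
        rw [← sum_mul, hF, abs_ncMoebius hn]
        split_ifs <;> simp [ht_def]
    _ = -∑ σ : NC n, (∏ B ∈ σ.1.parts, κ #B) * ∑ π : NC n with σ ≤ π, ncMoebius n π t := by
        simp_rw [mul_sum, sum_filter]
        rw [sum_comm]
    _ = -κ n := by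
        simp_rw [sum_moebius_filter_le _ t ht]
        simp [ht_def, parts_top hn]

end Moebius

/-- The generating function `y(z) = Σ_{n ≥ 1} ã_n z^n` satisfies `y(1-y)(1-y-z) = z²`. -/
theorem stmt13 :
    let Y : PowerSeries ℚ := PowerSeries.mk fun m => if m = 0 then 0 else atilde m
    Y * (1 - Y) * (1 - Y - PowerSeries.X) = PowerSeries.X ^ 2 := by
  intro Y
  obtain ⟨K, hK0, hK, hKM⟩ := exists_cumulantSeries
  have hY : Y = -K := by
    ext m
    simp only [Y, PowerSeries.coeff_mk, map_neg]
    split_ifs with hm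
    · simp [hm, hK0]
    · exact atilde_eq_neg (fun n hn => firstBlockSum_cumulant hKM hn) hm
  rw [hY, ← hK]
  ring
end
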